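/- Let G be a finitely generated group, A and B finite subgroups of G, and φ : A ≃* B an isomorphism. Suppose there exists g ∈ G such that either (for all a ∈ A, g⁻¹·a·g ∈ A implies a = 1) or (for all a ∈ A, g⁻¹·a·g ∈ B implies a = 1). Let P = HNNExtension G A B φ, Δ a finite type with decidable equality, and e : List Δ → P a surjective monoid homomorphism. Then the following are equivalent: (i) for every finite set W of words in List Δ, the predicate w ↦ (e w ∈ Submonoid.closure (e '' W)) is computable (ComputablePred); (ii) for every regular language L ⊆ List Δ, the predicate w ↦ (e w ∈ e '' L) is computable. (The submonoid membership problem and the rational subset membership problem for the HNN extension are recursively equivalent.) -/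

import Mathlib

/-- Any finite type with decidable equality is primcodable. -/
noncomputable instance (priority := 50) fintypePrimcodable {α : Type} [Fintype α] [DecidableEq α] :
    Primcodable α :=
  Primcodable.ofEquiv (Fin (Fintype.card α)) (Fintype.equivFin α)

section ComputabilityLemmas

theorem ComputablePred.comp_computable {α β : Type*} [Primcodable α] [Primcodable β]
    {p : β → Prop} (hp : ComputablePred p) {f : α → β} (hf : Computable f) :
    ComputablePred fun a => p (f a) := by
  obtain ⟨g, hg, rfl⟩ := ComputablePred.computable_iff.1 hp
  exact ComputablePred.computable_iff.2 ⟨fun a => g (f a), hg.comp hf, rfl⟩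

theorem ComputablePred.const_prop {α : Type*} [Primcodable α] (p : Prop) :
    ComputablePred fun _ : α => p := by
  classical exact Computable.computablePred (Computable.const (decide p))

theorem ComputablePred.of_finite {α : Type*} [Primcodable α] [Finite α] (p : α → Prop) :
    ComputablePred p := by
  classical exact Computable.computablePred (Primrec.dom_finite fun a => decide (p a)).to_comp

theorem ComputablePred.and_pred {α : Type*} [Primcodable α] {p q : α → Prop}
    (hp : ComputablePred p) (hq : ComputablePred q) : ComputablePred fun a => p a ∧ q a := by
  classical
  exact Computable.computablePred
    ((Primrec.and.to_comp.comp hp.decide hq.decide).of_eq fun a => by simp)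

theorem ComputablePred.or_pred {α : Type*} [Primcodable α] {p q : α → Prop}
    (hp : ComputablePred p) (hq : ComputablePred q) : ComputablePred fun a => p a ∨ q a := by
  classical
  exact Computable.computablePred
    ((Primrec.or.to_comp.comp hp.decide hq.decide).of_eq fun a => by simp)

theorem ComputablePred.iff_pred {α : Type*} [Primcodable α] {p q : α → Prop}
    (hp : ComputablePred p) (hq : ComputablePred q) : ComputablePred fun a => p a ↔ q a :=
  ((hp.and_pred hq).or_pred (hp.not.and_pred hq.not)).of_eq fun a => by tauto

theorem ComputablePred.exists_mem_finite {α ι : Type*} [Primcodable α] {s : Set ι}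
    (hs : s.Finite) {p : ι → α → Prop} (hp : ∀ i ∈ s, ComputablePred (p i)) :
    ComputablePred fun a => ∃ i ∈ s, p i a := by
  induction s, hs using Set.Finite.induction_on with
  | empty => simpa using ComputablePred.const_prop False
  | @insert i s _ _ ih =>
    refine ((hp i (Set.mem_insert _ _)).or_pred
      (ih fun j hj => hp j (Set.mem_insert_of_mem _ hj))).of_eq fun a => ?_
    simp

theorem ComputablePred.exists_finite {α ι : Type*} [Primcodable α] [Finite ι]
    {p : ι → α → Prop} (hp : ∀ i, ComputablePred (p i)) :
    ComputablePred fun a => ∃ i, p i a :=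
  (ComputablePred.exists_mem_finite Set.finite_univ fun i _ => hp i).of_eq fun a => by simp

theorem ComputablePred.forall_finite {α ι : Type*} [Primcodable α] [Finite ι]
    {p : ι → α → Prop} (hp : ∀ i, ComputablePred (p i)) :
    ComputablePred fun a => ∀ i, p i a :=
  (ComputablePred.exists_finite fun i => (hp i).not).not.of_eq fun a => by simp

theorem Computable.of_computablePred_fiber {α : Type*} [Primcodable α] {N : ℕ} {f : α → Fin N}
    (hf : ∀ i, ComputablePred fun a => f a = i) : Computable f := by
  classical
  have key : ∀ l : List (Fin N), Computable fun a => l.findIdx fun i => decide (f a = i) := by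
    intro l
    induction l with
    | nil => exact Computable.const 0
    | cons i l ih =>
      refine (Computable.cond (hf i).decide (Computable.const 0)
        (Computable.succ.comp ih)).of_eq fun a => ?_
      rw [List.findIdx_cons]
  have h2 := Computable.list_getElem?.comp (Computable.const (List.finRange N))
    (key (List.finRange N))
  refine Computable.option_some_iff.1 (h2.of_eq fun a => ?_)
  have hlt : (List.finRange N).findIdx (fun i => decide (f a = i)) < (List.finRange N).length :=
    List.findIdx_lt_length_of_exists ⟨f a, by simp, by simp⟩
  rw [List.getElem?_eq_getElem hlt]
  have := List.findIdx_getElem (w := hlt)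
  simpa using (of_decide_eq_true this).symm

theorem Computable.foldl_list {α σ : Type*} [Primcodable α] [Primcodable σ] {f : σ → α → σ}
    (hf : Computable₂ f) (s : σ) : Computable fun l : List α => l.foldl f s := by
  have h : Computable fun l : List α => Nat.rec (motive := fun _ => σ) s
      (fun n IH => (Option.casesOn (l[n]?) IH (fun a => f IH a) : σ)) l.length := by
    refine Computable.nat_rec Computable.list_length (Computable.const s)
      (h := fun (l : List α) (p : ℕ × σ) =>
        (Option.casesOn (l[p.1]?) p.2 (fun a => f p.2 a) : σ)) ?_
    refine Computable.option_casesOn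
      (Computable.list_getElem?.comp Computable.fst (Computable.fst.comp Computable.snd))
      (Computable.snd.comp Computable.snd) ?_
    exact hf.comp (Computable.snd.comp (Computable.snd.comp Computable.fst)) Computable.snd
  refine h.of_eq fun l => ?_
  have key : ∀ n ≤ l.length, (Nat.rec (motive := fun _ => σ) s
      (fun n IH => (Option.casesOn (l[n]?) IH (fun a => f IH a) : σ)) n) =
      (l.take n).foldl f s := by
    intro n hn
    induction n with
    | zero => simp
    | succ n ih =>
      have hlt : n < l.length := hn
      rw [List.take_add_one, List.foldl_append, ← ih hlt.le]
      simp [List.getElem?_eq_getElem hlt]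
  simpa using key l.length le_rfl

theorem NFA.computablePred_mem_accepts {α σ : Type*} [Primcodable α] [Finite σ] (M : NFA α σ)
    (hM : ∀ s s', ComputablePred fun a => s' ∈ M.step s a) :
    ComputablePred fun l : List α => l ∈ M.accepts := by
  classical
  obtain ⟨N, ⟨c⟩⟩ := Finite.exists_equiv_fin (Set σ)
  have hF : Computable₂ fun (i : Fin N) (a : α) => c (M.stepSet (c.symm i) a) := by
    refine Computable.of_computablePred_fiber
      (f := fun p : Fin N × α => c (M.stepSet (c.symm p.1) p.2)) fun j => ?_
    have h : ComputablePred fun p : Fin N × α => ∃ i, p.1 = i ∧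
        ∀ s', (s' ∈ c.symm j ↔ ∃ s, s ∈ c.symm i ∧ s' ∈ M.step s p.2) := by
      refine ComputablePred.exists_finite fun i => ComputablePred.and_pred ?_
        (ComputablePred.forall_finite fun s' => (ComputablePred.const_prop _).iff_pred
          (ComputablePred.exists_finite fun s => (ComputablePred.const_prop _).and_pred
            ((hM s s').comp_computable Computable.snd)))
      exact Computable.computablePred
        ((Primrec.dom_finite fun k : Fin N => decide (k = i)).to_comp.comp Computable.fst)
    refine h.of_eq fun p => ?_
    rw [← Equiv.eq_symm_apply, Set.ext_iff]
    simp only [exists_eq_left', NFA.mem_stepSet]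
    exact forall_congr' fun s => Iff.comm
  have hfold := Computable.foldl_list hF (c M.start)
  have hfin : ComputablePred fun i : Fin N => ∃ s ∈ M.accept, s ∈ c.symm i :=
    Computable.computablePred (Primrec.dom_finite _).to_comp
  refine (hfin.comp_computable hfold).of_eq fun l => ?_
  have key : ∀ (l : List α) (S : Set σ),
      l.foldl (fun (i : Fin N) (a : α) => c (M.stepSet (c.symm i) a)) (c S) =
        c (M.evalFrom S l) := by
    intro l
    induction l with
    | nil => intro S; rfl
    | cons a l ih => intro S; simp [ih]
  rw [key, Equiv.symm_apply_apply]
  rfl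

theorem ComputablePred.of_exists_witness {α β : Type*} [Primcodable α] [Primcodable β]
    {p : α → Prop} {q : β → Prop} {C : α → β → Prop}
    (hC : ComputablePred fun x : α × β => C x.1 x.2) (hq : ComputablePred q)
    (hex : ∀ a, ∃ b, C a b) (hpq : ∀ a b, C a b → (p a ↔ q b)) : ComputablePred p := by
  classical
  let C' : α → ℕ → Prop := fun a n => ∃ b, Encodable.decode n = some b ∧ C a b
  have hC' : ComputablePred fun x : α × ℕ => C' x.1 x.2 := by
    have hC2 : Computable₂ fun (x : α × ℕ) (b : β) => decide (C x.1 b) :=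
      hC.decide.comp (f := fun x : α × β => decide (C x.1 x.2))
        (g := fun y : (α × ℕ) × β => (y.1.1, y.2))
        (Computable.pair (Computable.fst.comp Computable.fst) Computable.snd)
    have h := Computable.option_casesOn
      ((Computable.decode (α := β)).comp (Computable.snd (α := α) (β := ℕ)))
      (Computable.const false) hC2
    refine Computable.computablePred (h.of_eq fun x => ?_)
    rw [Bool.eq_iff_iff, decide_eq_true_iff]
    cases hx : Encodable.decode (α := β) x.2 <;> simp [C', hx]
  have hex' : ∀ a, ∃ n, C' a n := fun a => by
    obtain ⟨b, hb⟩ := hex a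
    exact ⟨Encodable.encode b, b, Encodable.encodek b, hb⟩
  obtain ⟨F, hF, hFC⟩ : ∃ F : α → ℕ, Computable F ∧ ∀ a, C' a (F a) :=
    ⟨_, Computable.find hC' hex', fun a => Nat.find_spec (hex' a)⟩
  have hq' : Computable₂ fun (_ : α) (b : β) => decide (q b) := hq.decide.comp Computable.snd
  have h := Computable.option_casesOn ((Computable.decode (α := β)).comp hF)
    (Computable.const false) hq'
  refine Computable.computablePred (h.of_eq fun a => ?_)
  obtain ⟨b, hb, hCb⟩ := hFC a
  simp [hb, hpq a b hCb]

end ComputabilityLemmas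

section LabelledPaths

/-- `LabelledPath E p x q` says that `x` is the product of the labels along some path from `p` to
`q` in the graph with labelled edges `E`. -/
inductive LabelledPath {M Q : Type*} [Monoid M] (E : Set (Q × M × Q)) : Q → M → Q → Prop
  | nil (p : Q) : LabelledPath E p 1 p
  | cons {p q r : Q} {x y : M} : (p, x, q) ∈ E → LabelledPath E q y r → LabelledPath E p (x * y) r

namespace LabelledPath

variable {M Q : Type*} [Monoid M] {E : Set (Q × M × Q)}

theorem single {p q : Q} {x : M} (h : (p, x, q) ∈ E) : LabelledPath E p x q := by
  simpa using cons h (nil q)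

theorem trans {p q r : Q} {x y : M} (h₁ : LabelledPath E p x q) (h₂ : LabelledPath E q y r) :
    LabelledPath E p (x * y) r := by
  induction h₁ with
  | nil => simpa using h₂
  | cons he _ ih => rw [mul_assoc]; exact cons he (ih h₂)

end LabelledPath

theorem List.finite_setOf_eq_nil_or_suffix {α ι : Type*} {s : Set ι} (hs : s.Finite)
    (τ : ι → List α) : {l : List α | l = [] ∨ ∃ i ∈ s, l <:+ τ i}.Finite := by
  have h : ({[]} ∪ ⋃ i ∈ s, {l | l ∈ (τ i).tails} : Set (List α)).Finite :=
    (Set.finite_singleton _).union (hs.biUnion fun i _ => List.finite_toSet _)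
  refine h.subset fun l hl => ?_
  simpa using hl

theorem Language.IsRegular.exists_labelledPath.{u, v} {Δ : Type u} {P : Type v} [Finite Δ]
    [Monoid P]
    {S : Set P} (h_one : 1 ∈ S) (hS : Submonoid.closure S = ⊤) (e : FreeMonoid Δ →* P)
    {L : Language Δ} (hL : L.IsRegular) :
    ∃ (Q : Type v) (_ : Finite Q) (E : Set (Q × P × Q)) (p₀ : Q) (F : Set Q), E.Finite ∧
      (∀ p x q, (p, x, q) ∈ E → x ∈ S) ∧
      ∀ x, (x ∈ (fun v : List Δ => e (FreeMonoid.ofList v)) '' L ↔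
        ∃ q ∈ F, LabelledPath E p₀ x q) := by
  obtain ⟨σ, _, D, rfl⟩ := hL
  choose τ hτS hτ using fun d : Δ => Submonoid.exists_list_of_mem_closure
    (s := S) (x := e (FreeMonoid.of d)) (by rw [hS]; trivial)
  let R : Set (List P) := {l | l = [] ∨ ∃ d ∈ Set.univ, l <:+ τ d}
  have hR : R.Finite := List.finite_setOf_eq_nil_or_suffix Set.finite_univ τ
  have : Finite R := hR
  let ε : R := ⟨[], Or.inl rfl⟩
  have hRτ : ∀ d, τ d ∈ R := fun d => Or.inr ⟨d, trivial, List.suffix_rfl⟩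
  have hRtail : ∀ x l, x :: l ∈ R → l ∈ R := by
    rintro x l (h | ⟨d, -, h⟩)
    · cases h
    · exact Or.inr ⟨d, trivial, (List.suffix_cons x l).trans h⟩
  have hRS : ∀ l ∈ R, ∀ x ∈ l, x ∈ S := by
    rintro l (rfl | ⟨d, -, h⟩) x hx
    · simp at hx
    · exact hτS d x (h.subset hx)
  let E : Set ((σ × R) × P × (σ × R)) := {y | y.2.1 = y.1.2.1.headD 1 ∧
    ((y.1.1 = y.2.2.1 ∧ y.1.2.1 = y.2.1 :: y.2.2.2.1) ∨
      (y.1.2.1 = [] ∧ ∃ d, y.2.2.1 = D.step y.1.1 d ∧ y.2.2.2.1 = τ d))}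
  have read : ∀ s (l : List P) (hl : l ∈ R), LabelledPath E (s, ⟨l, hl⟩) l.prod (s, ε) := by
    intro s l
    induction l with
    | nil => intro hl; exact LabelledPath.nil _
    | cons x l ih =>
      intro hl
      rw [List.prod_cons]
      refine LabelledPath.cons (q := (s, ⟨l, hRtail x l hl⟩)) ?_ (ih _)
      simp [E]
  have fwd : ∀ (v : List Δ) s,
      LabelledPath E (s, ε) (e (FreeMonoid.ofList v)) (D.evalFrom s v, ε) := by
    intro v
    induction v with
    | nil => intro s; simpa using LabelledPath.nil _
    | cons d v ih =>
      intro s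
      have h₁ : LabelledPath E (s, ε) 1 (D.step s d, ⟨τ d, hRτ d⟩) :=
        LabelledPath.single ⟨rfl, Or.inr ⟨rfl, d, rfl, rfl⟩⟩
      have h₂ := (h₁.trans (read _ _ _)).trans (ih (D.step s d))
      rwa [one_mul, hτ, ← map_mul] at h₂
  have bwd : ∀ p x q, LabelledPath E p x q → q.2 = ε →
      ∃ v : List Δ, x = p.2.1.prod * e (FreeMonoid.ofList v) ∧ q.1 = D.evalFrom p.1 v := by
    intro p x q h hq
    induction h with
    | nil p => exact ⟨[], by simp [hq, ε], rfl⟩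
    | @cons p q r x y he _ ih =>
      obtain ⟨v, rfl, hv⟩ := ih hq
      obtain ⟨h0, ⟨h1, h2⟩ | ⟨h1, d, h2, h3⟩⟩ := he
      · dsimp only at h0 h1 h2
        exact ⟨v, by rw [h2]; simp [mul_assoc], by rw [hv, h1]⟩
      · dsimp only at h0 h1 h2 h3
        refine ⟨d :: v, ?_, by rw [hv, h2]; rfl⟩
        rw [h0, h1, h3, hτ, FreeMonoid.ofList_cons, map_mul]
        simp
  refine ⟨σ × R, inferInstance, E, (D.start, ε), {q | q.1 ∈ D.accept ∧ q.2 = ε}, ?_, ?_, ?_⟩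
  · refine (Set.finite_range fun z : (σ × R) × (σ × R) => (z.1, z.1.2.1.headD 1, z.2)).subset ?_
    rintro ⟨p, x, q⟩ ⟨h, -⟩
    exact ⟨(p, q), by dsimp only at h ⊢; rw [← h]⟩
  · rintro p x q ⟨h, h' | h'⟩
    · exact hRS p.2.1 p.2.2 x (by rw [h'.2]; simp)
    · have : x = 1 := by
        dsimp only at h h'
        rw [h, h'.1, List.headD_nil]
      rwa [this]
  · intro x
    constructor
    · rintro ⟨v, hv, rfl⟩
      exact ⟨(D.evalFrom D.start v, ε), ⟨hv, rfl⟩, fwd v D.start⟩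
    · rintro ⟨q, ⟨hq, hqε⟩, h⟩
      obtain ⟨v, rfl, hv⟩ := bwd _ _ _ h hqε
      refine ⟨v, ?_, by simp [ε]⟩
      rw [hv] at hq
      exact hq

open Computability in
theorem Language.isRegular_kstar_of_finite {Δ : Type*} {W : Language Δ}
    (hW : Set.Finite (W : Set (List Δ))) : (W∗).IsRegular := by
  let R : Set (List Δ) := {l | l = [] ∨ ∃ w ∈ (W : Set (List Δ)), l <:+ w}
  have hR : R.Finite := List.finite_setOf_eq_nil_or_suffix hW id
  have : Finite R := hR
  let ε : R := ⟨[], Or.inl rfl⟩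
  let N : NFA Δ R :=
    { step := fun l x => {l' | l.1 = x :: l'.1 ∨ (l.1 = [] ∧ x :: l'.1 ∈ W)}
      start := {ε}
      accept := {ε} }
  have key : ∀ (w : List Δ) (l : R), ε ∈ N.evalFrom {l} w ↔ ∃ v ∈ W∗, w = l.1 ++ v := by
    intro w
    induction w with
    | nil =>
      intro l
      simp only [NFA.evalFrom_nil, Set.mem_singleton_iff]
      constructor
      · rintro rfl
        exact ⟨[], Language.nil_mem_kstar _, rfl⟩
      · rintro ⟨v, -, hv⟩
        exact Subtype.ext (by simp [ε, (List.append_eq_nil_iff.1 hv.symm).1])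
    | cons x w ih =>
      intro l
      rw [NFA.evalFrom_cons, NFA.stepSet_singleton, NFA.mem_evalFrom_iff_exists]
      simp only [ih]
      constructor
      · rintro ⟨l', hl' | ⟨hl, hl'⟩, v, hv, rfl⟩
        · exact ⟨v, hv, by rw [hl']; rfl⟩
        · refine ⟨x :: l'.1 ++ v, ?_, by rw [hl]; rfl⟩
          rw [← Language.one_add_self_mul_kstar_eq_kstar]
          exact Or.inr (Language.append_mem_mul hl' hv)
      · rintro ⟨v, hv, h⟩
        obtain ⟨l, hl⟩ := l
        cases l with
        | cons y l =>
          obtain ⟨rfl, rfl⟩ : x = y ∧ w = l ++ v := by simpa using h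
          have hl' : l ∈ R := by
            obtain hnil | ⟨u, hu, hsuf⟩ := hl
            · cases hnil
            · exact Or.inr ⟨u, hu, (List.suffix_cons x l).trans hsuf⟩
          exact ⟨⟨l, hl'⟩, Or.inl rfl, v, hv, rfl⟩
        | nil =>
          obtain rfl : x :: w = v := by simpa using h
          obtain ⟨Ls, hLs, hmem⟩ := Language.mem_kstar_iff_exists_nonempty.1 hv
          cases Ls with
          | nil => simp at hLs
          | cons u Ls =>
            obtain ⟨hu, hne⟩ := hmem u (by simp)
            cases u with
            | nil => exact absurd rfl hne
            | cons y u =>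
              obtain ⟨rfl, rfl⟩ : x = y ∧ w = u ++ Ls.flatten := by simpa using hLs
              refine ⟨⟨u, Or.inr ⟨_, hu, List.suffix_cons _ _⟩⟩, Or.inr ⟨rfl, hu⟩,
                Ls.flatten, ?_, rfl⟩
              exact Language.join_mem_kstar fun y hy => (hmem y (List.mem_cons_of_mem _ hy)).1
  classical
  have := Fintype.ofFinite R
  refine Language.isRegular_iff.2 ⟨Set R, inferInstance, N.toDFA, ?_⟩
  rw [NFA.toDFA_correct]
  ext w
  rw [NFA.mem_accepts]
  have : (∃ S ∈ N.accept, S ∈ N.evalFrom N.start w) ↔ ε ∈ N.evalFrom {ε} w := by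
    simp [N]
  rw [this, key]
  simp [ε]

theorem Submonoid.closure_image_eq_image_kstar {Δ P : Type*} [Monoid P] (e : FreeMonoid Δ →* P)
    (W : Language Δ) :
    (Submonoid.closure ((fun v : List Δ => e (FreeMonoid.ofList v)) '' W) : Set P) =
      (fun v : List Δ => e (FreeMonoid.ofList v)) '' KStar.kstar (α := Language Δ) W := by
  apply Set.Subset.antisymm
  · intro x hx
    refine Submonoid.closure_induction ?_ ?_ ?_ hx
    · rintro _ ⟨v, hv, rfl⟩
      have h := Language.join_mem_kstar (l := W) (L := [v]) fun y hy => by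
        rw [List.mem_singleton.1 hy]; exact hv
      rw [List.flatten_singleton] at h
      exact ⟨v, h, rfl⟩
    · exact ⟨[], Language.nil_mem_kstar _, by simp⟩
    · rintro _ _ _ _ ⟨u, hu, rfl⟩ ⟨v, hv, rfl⟩
      refine ⟨u ++ v, ?_, by simp⟩
      rw [← kstar_mul_kstar]
      exact Language.append_mem_mul hu hv
  · rintro _ ⟨v, hv, rfl⟩
    obtain ⟨Ls, rfl, hLs⟩ := Language.mem_kstar.1 hv
    clear hv
    induction Ls with
    | nil => simp
    | cons u Ls ih =>
      simp only [List.flatten_cons, FreeMonoid.ofList_append, map_mul]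
      exact Submonoid.mul_mem _ (Submonoid.subset_closure ⟨u, hLs u (by simp), rfl⟩)
        (ih fun y hy => hLs y (List.mem_cons_of_mem _ hy))

end LabelledPaths

namespace HNNExtension

variable {G : Type*} [Group G] {A B : Subgroup G} (φ : A ≃* B)

/-- The product in the HNN extension of the syllables `t ^ u * g`, for `(u, g)` in a list. -/
def syllableProd (l : List (ℤˣ × G)) : HNNExtension G A B φ :=
  (l.map fun x => t ^ (x.1 : ℤ) * of x.2).prod

@[simp]
theorem syllableProd_nil : syllableProd φ [] = 1 := rfl

@[simp]
theorem syllableProd_cons (x : ℤˣ × G) (l : List (ℤˣ × G)) :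
    syllableProd φ (x :: l) = t ^ (x.1 : ℤ) * of x.2 * syllableProd φ l := by
  simp [syllableProd]

@[simp]
theorem syllableProd_append (l m : List (ℤˣ × G)) :
    syllableProd φ (l ++ m) = syllableProd φ l * syllableProd φ m := by
  simp [syllableProd]

variable (A B) in
/-- A list of syllables is reduced if it contains no pinch `t ^ u * g * t ^ (-u)` with
`g ∈ toSubgroup A B u`. -/
def IsReduced (l : List (ℤˣ × G)) : Prop :=
  l.IsChain fun a b => a.2 ∈ toSubgroup A B a.1 → a.1 = b.1

variable (A B) in
theorem toSubgroup_le_union (u : ℤˣ) : (toSubgroup A B u : Set G) ⊆ A ∪ B := by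
  rcases Int.units_eq_one_or u with rfl | rfl
  · exact Set.subset_union_left
  · exact Set.subset_union_right

theorem exists_t_zpow_mul_of (u : ℤˣ) {a : G} (ha : a ∈ toSubgroup A B u) :
    ∃ b ∈ toSubgroup A B (-u),
      (t ^ (u : ℤ) * of a : HNNExtension G A B φ) = of b * t ^ (u : ℤ) := by
  rcases Int.units_eq_one_or u with rfl | rfl
  · exact ⟨φ ⟨a, ha⟩, (φ ⟨a, ha⟩).2, by simpa using t_mul_of (φ := φ) ⟨a, ha⟩⟩
  · exact ⟨φ.symm ⟨a, ha⟩, (φ.symm ⟨a, ha⟩).2, by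
      simpa using inv_t_mul_of (φ := φ) ⟨a, ha⟩⟩

theorem exists_of_mul_t_zpow (u : ℤˣ) {a : G} (ha : a ∈ toSubgroup A B (-u)) :
    ∃ b ∈ toSubgroup A B u,
      (of a * t ^ (u : ℤ) : HNNExtension G A B φ) = t ^ (u : ℤ) * of b := by
  obtain ⟨b, hb, h⟩ := exists_t_zpow_mul_of φ (-u) ha
  rw [neg_neg] at hb
  refine ⟨b, hb, ?_⟩
  rw [Units.val_neg, zpow_neg, inv_mul_eq_iff_eq_mul, ← mul_assoc, eq_mul_inv_iff_mul_eq] at h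
  exact h

theorem map_fst_eq_of_syllableProd_eq {l m : List (ℤˣ × G)} (hl : IsReduced A B l)
    (hm : IsReduced A B m) {c : G} (h : of c * syllableProd φ m = syllableProd φ l) :
    m.map Prod.fst = l.map Prod.fst ∧ ∀ u ∈ m.head?.map Prod.fst, c ∈ toSubgroup A B (-u) := by
  have := ReducedWord.map_fst_eq_and_of_prod_eq φ
    (w₁ := ⟨c, m, hm⟩) (w₂ := ⟨1, l, hl⟩)
    (by simpa [NormalWord.ReducedWord.prod, syllableProd] using h)
  simpa using this

theorem mem_union_of_syllableProd_eq {l m : List (ℤˣ × G)} (hl : IsReduced A B l)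
    (hm : IsReduced A B m) {c : G} (h : of c * syllableProd φ m = syllableProd φ l) :
    c ∈ (A ∪ B : Set G) := by
  obtain ⟨h1, h2⟩ := map_fst_eq_of_syllableProd_eq φ hl hm h
  cases m with
  | nil =>
    obtain rfl : l = [] := by simpa using h1.symm
    have : c = 1 := of_injective (φ := φ) (by simpa using h)
    rw [this]
    exact Or.inl A.one_mem
  | cons x m => exact toSubgroup_le_union A B _ (h2 x.1 (by simp))

section Saturation

variable {φ} {Q : Type*} (E : Set (Q × HNNExtension G A B φ × Q))

/-- The edges with label in the base group, together with shortcut edges for all paths whose label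
lies in an associated subgroup. -/
def baseEdges : Set (Q × G × Q) :=
  {y | (y.1, of y.2.1, y.2.2) ∈ E ∨
    (y.2.1 ∈ (A ∪ B : Set G) ∧ LabelledPath E y.1 (of y.2.1) y.2.2)}

variable {E} in
theorem finite_baseEdges [Finite Q] (hA : (A : Set G).Finite) (hB : (B : Set G).Finite)
    (hE : E.Finite) : (baseEdges E).Finite := by
  refine Set.Finite.union ?_ (((Set.finite_univ (α := Q)).prod
    ((hA.union hB).prod (Set.finite_univ (α := Q)))).subset ?_)
  · refine hE.preimage (f := fun y : Q × G × Q => (y.1, of y.2.1, y.2.2)) ?_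
    rintro ⟨p, x, q⟩ - ⟨p', x', q'⟩ - h
    simp only [Prod.mk.injEq, (of_injective (φ := φ)).eq_iff] at h
    simp [h]
  · rintro ⟨p, x, q⟩ ⟨h, -⟩
    exact ⟨trivial, h, trivial⟩

variable {E} in
theorem labelledPath_of_baseEdges {p q : Q} {g : G} (h : LabelledPath (baseEdges E) p g q) :
    LabelledPath E p (of g) q := by
  induction h with
  | nil p => simpa using LabelledPath.nil p
  | cons he _ ih =>
    rw [map_mul]
    rcases he with he | ⟨-, he⟩
    · exact LabelledPath.cons he ih
    · exact he.trans ih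

/-- A list of syllables can be read from `p` to `q` along stable letters in `E` and paths in
`baseEdges E`. -/
def ReadsTo (q : Q) : List (ℤˣ × G) → Q → Prop
  | [], p => p = q
  | (u, g) :: l, p => ∃ p₁ p₂, (p, t ^ (u : ℤ), p₁) ∈ E ∧
      LabelledPath (baseEdges E) p₁ g p₂ ∧ ReadsTo q l p₂

/-- The product of `c` and a list of syllables can be read from `p` to `q`, up to moving elements
of the associated subgroups across the stable letters. -/
def TwistedReadsTo (q : Q) : List (ℤˣ × G) → Q → G → Prop
  | [], p, c => p = q ∧ c = 1
  | (u, h) :: m, p, c => ∃ p₂, ∃ c₂ ∈ (A ∪ B : Set G),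
      (∃ p₁, ∃ c' ∈ (A ∪ B : Set G), (p, t ^ (u : ℤ), p₁) ∈ E ∧
        (of c * t ^ (u : ℤ) : HNNExtension G A B φ) = t ^ (u : ℤ) * of c' ∧
        LabelledPath (baseEdges E) p₁ (c' * h * c₂⁻¹) p₂) ∧ TwistedReadsTo q m p₂ c₂

variable {E}

theorem TwistedReadsTo.labelledPath {q : Q} {m : List (ℤˣ × G)} {p : Q} {c : G}
    (h : TwistedReadsTo E q m p c) : LabelledPath E p (of c * syllableProd φ m) q := by
  induction m generalizing p c with
  | nil =>
    obtain ⟨rfl, rfl⟩ := h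
    simpa using LabelledPath.nil p
  | cons x m ih =>
    obtain ⟨u, h⟩ := x
    obtain ⟨p₂, c₂, -, ⟨p₁, c', -, he, hc, hp⟩, hm⟩ := h
    have := (LabelledPath.single he).trans ((labelledPath_of_baseEdges hp).trans (ih hm))
    rw [syllableProd_cons, ← mul_assoc, ← mul_assoc, hc]
    simpa [mul_assoc] using this

theorem ReadsTo.twistedReadsTo {q : Q} {l m : List (ℤˣ × G)} {p : Q} {c : G}
    (hr : ReadsTo E q l p) (hl : IsReduced A B l) (hm : IsReduced A B m)
    (h : of c * syllableProd φ m = syllableProd φ l) : TwistedReadsTo E q m p c := by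
  induction m generalizing l p c with
  | nil =>
    obtain ⟨h1, -⟩ := map_fst_eq_of_syllableProd_eq φ hl hm h
    obtain rfl : l = [] := by simpa using h1.symm
    exact ⟨hr, of_injective (φ := φ) (by simpa using h)⟩
  | cons x m ih =>
    obtain ⟨u, k⟩ := x
    obtain ⟨h1, h2⟩ := map_fst_eq_of_syllableProd_eq φ hl hm h
    cases l with
    | nil => simp at h1
    | cons y l =>
      obtain ⟨u', g⟩ := y
      obtain ⟨rfl, -⟩ : u = u' ∧ _ := by simpa using h1
      obtain ⟨p₁, p₂, he, hp, hr⟩ := hr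
      obtain ⟨c', hc', hcc'⟩ := exists_of_mul_t_zpow φ u (h2 u (by simp))
      have hl' := List.IsChain.tail hl
      have hm' := List.IsChain.tail hm
      have h' : of (g⁻¹ * c' * k) * syllableProd φ m = syllableProd φ l := by
        rw [syllableProd_cons, syllableProd_cons, ← mul_assoc, ← mul_assoc, hcc', mul_assoc,
          mul_assoc, mul_assoc, mul_left_cancel_iff] at h
        rw [map_mul, map_mul, map_inv, mul_assoc, mul_assoc, h, inv_mul_cancel_left]
      refine ⟨p₂, g⁻¹ * c' * k, mem_union_of_syllableProd_eq φ hl' hm' h',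
        ⟨p₁, c', toSubgroup_le_union A B u hc', he, hcc', ?_⟩, ih hr hl' hm' h'⟩
      convert hp using 1
      group

theorem _root_.LabelledPath.exists_isReduced_readsTo
    (hE : ∀ p x q, (p, x, q) ∈ E → (∃ g, x = of g) ∨ ∃ u : ℤˣ, x = t ^ (u : ℤ))
    {p q : Q} {x : HNNExtension G A B φ} (h : LabelledPath E p x q) :
    ∃ g l p₁, LabelledPath (baseEdges E) p g p₁ ∧ ReadsTo E q l p₁ ∧ IsReduced A B l ∧
      x = of g * syllableProd φ l := by
  induction h with
  | nil p => exact ⟨1, [], p, LabelledPath.nil p, rfl, List.isChain_nil, by simp⟩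
  | @cons p q r x y he hp ih =>
    obtain ⟨g, l, p₁, hg, hl, hred, rfl⟩ := ih
    rcases hE _ _ _ he with ⟨g₀, rfl⟩ | ⟨u, rfl⟩
    · exact ⟨g₀ * g, l, p₁, LabelledPath.cons (Or.inl he) hg, hl, hred, by simp [mul_assoc]⟩
    · by_cases hpinch : ∀ b ∈ l.head?, g ∈ toSubgroup A B u → u = b.1
      · exact ⟨1, (u, g) :: l, p, LabelledPath.nil p, ⟨q, p₁, he, hg, hl⟩,
          List.isChain_cons.2 ⟨hpinch, hred⟩, by simp [mul_assoc]⟩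
      · push Not at hpinch
        obtain ⟨⟨u', g'⟩, hb, hgu, huu'⟩ := hpinch
        cases l with
        | nil => simp at hb
        | cons z l =>
          obtain rfl : z = (u', g') := by simpa using hb
          obtain rfl : u' = -u := by
            rcases Int.units_eq_one_or u with rfl | rfl <;>
            rcases Int.units_eq_one_or u' with rfl | rfl <;> simp_all
          obtain ⟨p₂, p₃, he₂, hg', hl'⟩ := hl
          obtain ⟨b, hb, hgb⟩ := exists_t_zpow_mul_of φ u hgu
          have hcancel : (t ^ (u : ℤ) * (of g * t ^ ((-u : ℤˣ) : ℤ)) : HNNExtension G A B φ) =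
              of b := by
            rw [← mul_assoc, hgb, Units.val_neg, zpow_neg, mul_inv_cancel_right]
          have hpath := LabelledPath.cons he
            ((labelledPath_of_baseEdges hg).trans (LabelledPath.single he₂))
          rw [hcancel] at hpath
          refine ⟨b * g', l, p₃, LabelledPath.cons
            (Or.inr ⟨toSubgroup_le_union A B _ hb, hpath⟩) hg', hl', List.IsChain.tail hred, ?_⟩
          rw [syllableProd_cons, map_mul, ← hcancel]
          simp only [mul_assoc]

theorem labelledPath_iff_twistedReadsTo
    (hE : ∀ p x q, (p, x, q) ∈ E → (∃ g, x = of g) ∨ ∃ u : ℤˣ, x = t ^ (u : ℤ))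
    {p q : Q} {h₀ : G} {m : List (ℤˣ × G)} (hm : IsReduced A B m) :
    LabelledPath E p (of h₀ * syllableProd φ m) q ↔
      ∃ p₁, ∃ c ∈ (A ∪ B : Set G), LabelledPath (baseEdges E) p (h₀ * c⁻¹) p₁ ∧
        TwistedReadsTo E q m p₁ c := by
  constructor
  · intro h
    obtain ⟨g, l, p₁, hg, hl, hred, heq⟩ := h.exists_isReduced_readsTo hE
    have h' : of (g⁻¹ * h₀) * syllableProd φ m = syllableProd φ l := by
      rw [map_mul, mul_assoc, heq, map_inv, inv_mul_cancel_left]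
    exact ⟨p₁, g⁻¹ * h₀, mem_union_of_syllableProd_eq φ hred hm h', by simpa using hg,
      hl.twistedReadsTo hred hm h'⟩
  · rintro ⟨p₁, c, -, hp, hT⟩
    have := (labelledPath_of_baseEdges hp).trans hT.labelledPath
    rwa [← mul_assoc, ← map_mul, inv_mul_cancel_right] at this

end Saturation

theorem exists_isReduced_eq (x : HNNExtension G A B φ) :
    ∃ (g : G) (m : List (ℤˣ × G)), IsReduced A B m ∧ x = of g * syllableProd φ m := by
  obtain ⟨d⟩ := NormalWord.TransversalPair.nonempty G A B
  let w := (NormalWord.equiv φ d) x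
  refine ⟨w.head, w.toList, w.chain, ?_⟩
  exact ((NormalWord.equiv φ d).symm_apply_apply x).symm

end HNNExtension

section PathEncoding

variable {P G Q : Type*} [Group P] [Group G]

theorem mem_closure_iff_labelledPath (ι : G →* P) (T : Q → P) (k s : P) (S : Subsemigroup P)
    (hN : ∀ i g j, ¬(i = j ∧ g = 1) → T i * s * ι g * s⁻¹ * (T j)⁻¹ * k⁻¹ ∈ S)
    (hT : ∀ i j, i ≠ j → (T i)⁻¹ * T j * k ∈ S) (h_one : 1 ∉ S) (hk : k⁻¹ ∉ S)
    (E : Set (Q × G × Q)) (p : Q) (g : G) (q : Q) :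
    (T p * k * T p * s) * ι g * (T q * k * T q * s)⁻¹ ∈
      Submonoid.closure ((fun y : Q × G × Q =>
        (T y.1 * k * T y.1 * s) * ι y.2.1 * (T y.2.2 * k * T y.2.2 * s)⁻¹) '' E) ↔
      LabelledPath E p g q := by
  set F : Q × G × Q → P := fun y =>
    (T y.1 * k * T y.1 * s) * ι y.2.1 * (T y.2.2 * k * T y.2.2 * s)⁻¹ with hF
  change F (p, g, q) ∈ _ ↔ _
  have F_mul : ∀ i g j g' j', F (i, g, j) * F (j, g', j') = F (i, g * g', j') := by
    intro i g j g' j'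
    simp only [hF, map_mul]
    group
  have F_one : ∀ i, F (i, 1, i) = 1 := by
    intro i
    simp only [hF, map_one]
    group
  let Red : List (Q × G × Q) → Prop := fun L =>
    (∀ b ∈ L, ¬(b.1 = b.2.2 ∧ b.2.1 = 1)) ∧ L.IsChain fun b b' => b.2.2 ≠ b'.1
  have shape : ∀ (L : List (Q × G × Q)) (b : Q × G × Q), Red (b :: L) →
      ∃ j, ∃ n ∈ S, (F b * (L.map F).prod) = T b.1 * k * n * (T j)⁻¹ := by
    intro L
    induction L with
    | nil =>
      rintro ⟨i, g, j⟩ ⟨h, -⟩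
      refine ⟨j, _, hN i g j (h (i, g, j) (List.mem_cons_self ..)), ?_⟩
      simp only [hF, List.map_nil, List.prod_nil]
      group
    | cons b' L ih =>
      rintro ⟨i, g, j⟩ ⟨h, hch⟩
      rw [List.isChain_cons_cons] at hch
      obtain ⟨j', n, hn, hprod⟩ := ih b' ⟨fun b hb => h b (List.mem_cons_of_mem _ hb), hch.2⟩
      refine ⟨j', _, S.mul_mem (S.mul_mem (hN i g j (h (i, g, j) (List.mem_cons_self ..)))
        (hT j b'.1 hch.1)) hn, ?_⟩
      rw [List.map_cons, List.prod_cons, hprod]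
      simp only [hF]
      group
  have prod_ne_one : ∀ (L : List (Q × G × Q)) (b : Q × G × Q), Red (b :: L) →
      F b * (L.map F).prod ≠ 1 := by
    intro L b h h1
    obtain ⟨j, n, hn, hprod⟩ := shape L b h
    rw [h1] at hprod
    by_cases hj : j = b.1
    · subst hj
      apply hk
      convert hn using 1
      rw [inv_eq_iff_mul_eq_one]
      have := congrArg (fun x => (T b.1)⁻¹ * x * T b.1) hprod
      simpa [mul_assoc] using this.symm
    · apply h_one
      convert S.mul_mem (hT j b.1 hj) hn using 1
      have := congrArg (fun x => (T j)⁻¹ * x * T j) hprod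
      simpa [mul_assoc] using this
  constructor
  · have normal : ∀ x ∈ Submonoid.closure (F '' E), ∃ L : List (Q × G × Q), Red L ∧
        (∀ b ∈ L, LabelledPath E b.1 b.2.1 b.2.2) ∧ x = (L.map F).prod := by
      intro x hx
      induction hx using Submonoid.closure_induction_left with
      | one => exact ⟨[], ⟨by simp, List.isChain_nil⟩, by simp, by simp⟩
      | mul_left x hx y hy ih =>
        obtain ⟨⟨i, g, j⟩, hb, rfl⟩ := hx
        obtain ⟨L, hL, hpath, rfl⟩ := ih
        have hbp := LabelledPath.single hb
        by_cases hb1 : i = j ∧ g = 1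
        · obtain ⟨rfl, rfl⟩ := hb1
          exact ⟨L, hL, hpath, by rw [F_one, one_mul]⟩
        rcases L with _ | ⟨⟨i', g', j'⟩, L⟩
        · exact ⟨[(i, g, j)], ⟨by simpa using hb1, List.isChain_singleton _⟩,
            by simpa using hbp, by simp⟩
        by_cases hij : j = i'
        · subst hij
          have hp := hpath _ (List.mem_cons_self ..)
          by_cases hm : i = j' ∧ g * g' = 1
          · obtain ⟨rfl, hm⟩ := hm
            exact ⟨L, ⟨fun b hb => hL.1 b (List.mem_cons_of_mem _ hb), hL.2.tail⟩,
              fun b hb => hpath b (List.mem_cons_of_mem _ hb), by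
              rw [List.map_cons, List.prod_cons, ← mul_assoc, F_mul, hm, F_one, one_mul]⟩
          · refine ⟨(i, g * g', j') :: L, ⟨?_, ?_⟩, ?_, ?_⟩
            · exact List.forall_mem_cons.2
                ⟨hm, fun b hb => hL.1 b (List.mem_cons_of_mem _ hb)⟩
            · have := hL.2
              rw [List.isChain_cons] at this ⊢
              exact this
            · exact List.forall_mem_cons.2
                ⟨hbp.trans hp, fun b hb => hpath b (List.mem_cons_of_mem _ hb)⟩
            · rw [List.map_cons, List.prod_cons, ← mul_assoc, F_mul, List.map_cons,
                List.prod_cons]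
        · exact ⟨(i, g, j) :: (i', g', j') :: L, ⟨List.forall_mem_cons.2 ⟨hb1, hL.1⟩,
            List.isChain_cons_cons.2 ⟨hij, hL.2⟩⟩, List.forall_mem_cons.2 ⟨hbp, hpath⟩, by simp⟩
    intro h
    obtain ⟨L, hL, hpath, hprod⟩ := normal _ h
    have h1 : F (q, g⁻¹, p) * (L.map F).prod = 1 := by
      rw [← hprod, F_mul, inv_mul_cancel, F_one]
    by_cases hb1 : q = p ∧ g⁻¹ = 1
    · obtain ⟨rfl, hb1⟩ := hb1
      rw [inv_eq_one.1 hb1]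
      exact LabelledPath.nil q
    rcases L with _ | ⟨⟨i', g', j'⟩, L⟩
    · exact absurd h1 (prod_ne_one [] _ ⟨by simpa using hb1, List.isChain_singleton _⟩)
    by_cases hij : p = i'
    · subst hij
      have hp := hpath _ (List.mem_cons_self ..)
      by_cases hm : q = j' ∧ g⁻¹ * g' = 1
      · obtain ⟨rfl, hm⟩ := hm
        rwa [inv_mul_eq_one.1 hm]
      · rw [List.map_cons, List.prod_cons, ← mul_assoc, F_mul] at h1
        refine absurd h1 (prod_ne_one L _ ⟨?_, ?_⟩)
        · exact List.forall_mem_cons.2 ⟨hm, fun b hb => hL.1 b (List.mem_cons_of_mem _ hb)⟩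
        · have := hL.2
          rw [List.isChain_cons] at this ⊢
          exact this
    · exact absurd h1 (prod_ne_one _ _ ⟨List.forall_mem_cons.2 ⟨hb1, hL.1⟩,
        List.isChain_cons_cons.2 ⟨hij, hL.2⟩⟩)
  · intro h
    induction h with
    | nil p => rw [F_one]; exact Submonoid.one_mem _
    | @cons p q r x y he _ ih =>
      rw [← F_mul p x q]
      exact Submonoid.mul_mem _ (Submonoid.subset_closure ⟨_, he, rfl⟩) ih

end PathEncoding

namespace HNNExtension

variable {G : Type*} [Group G] {A B : Subgroup G} (φ : A ≃* B)

/-- The elements with a reduced factorization that ends in an element of the base group outside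
both associated subgroups. -/
def freeEnded : Subsemigroup (HNNExtension G A B φ) where
  carrier := {x | ∃ l u g, IsReduced A B (l ++ [(u, g)]) ∧ g ∉ A ∧ g ∉ B ∧
    x = syllableProd φ (l ++ [(u, g)])}
  mul_mem' := by
    rintro _ _ ⟨l, u, g, hl, hgA, hgB, rfl⟩ ⟨m, v, h, hm, hhA, hhB, rfl⟩
    refine ⟨l ++ [(u, g)] ++ m, v, h, ?_, hhA, hhB, by simp [mul_assoc]⟩
    rw [List.append_assoc, IsReduced, List.isChain_append]
    refine ⟨hl, hm, fun x hx y _ hxu => ?_⟩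
    obtain rfl : (u, g) = x := by simpa using hx
    rcases toSubgroup_le_union A B _ hxu with h | h
    · exact absurd h hgA
    · exact absurd h hgB

variable {φ}

theorem of_notMem_freeEnded (g : G) : (of g : HNNExtension G A B φ) ∉ freeEnded φ := by
  rintro ⟨l, u, h, hl, -, -, heq⟩
  have := (map_fst_eq_of_syllableProd_eq φ hl (m := []) List.isChain_nil
    (c := g) (by simpa using heq)).1
  simp at this

theorem syllableProd_replicate (u : ℤˣ) (n : ℕ) :
    syllableProd φ (List.replicate n (u, 1)) = t ^ ((u : ℤ) * n) := by
  simp [syllableProd, zpow_mul]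

theorem isReduced_replicate_append {u : ℤˣ} (n : ℕ) {l : List (ℤˣ × G)} (hl : IsReduced A B l)
    (h : ∀ x ∈ l.head?, x.1 = u) : IsReduced A B (List.replicate n (u, 1) ++ l) := by
  rw [IsReduced, List.isChain_append]
  refine ⟨List.isChain_replicate_of_rel _ fun _ => rfl, hl, fun x hx y hy _ => ?_⟩
  rw [List.eq_of_mem_replicate (List.mem_of_mem_getLast? hx), h y hy]

theorem t_zpow_mul_of_mem_freeEnded {g : G} (hgA : g ∉ A) (hgB : g ∉ B) {d : ℤ} (hd : d ≠ 0) :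
    t ^ d * of g ∈ freeEnded φ := by
  obtain ⟨u, n, rfl⟩ : ∃ (u : ℤˣ) (n : ℕ), d = u * (n + 1) := by
    rcases lt_or_gt_of_ne hd with h | h
    · exact ⟨-1, (-d - 1).toNat, by push_cast; omega⟩
    · exact ⟨1, (d - 1).toNat, by push_cast; omega⟩
  refine ⟨List.replicate n (u, 1), u, g, isReduced_replicate_append n
    (List.isChain_singleton _) (by simp), hgA, hgB, ?_⟩
  rw [syllableProd_append, syllableProd_replicate]
  simp only [syllableProd_cons, syllableProd_nil, mul_one, ← mul_assoc, ← zpow_add, mul_add]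

end HNNExtension

namespace HNNExtension

variable {G : Type*} [Group G] {A B : Subgroup G} {φ : A ≃* B}

theorem conj_mem_freeEnded {u : ℤˣ} {c k : G} (hc : c ∈ A → u = -1)
    (hcu : ∀ a ∈ A, c * a * c⁻¹ ∈ toSubgroup A B u → a = 1) (hkA : k ∉ A) (hkB : k ∉ B)
    {i j : ℕ} {g : G} (h : ¬(i = j ∧ g = 1)) :
    (t ^ ((u : ℤ) * i) * (t ^ (u : ℤ) * of c * t⁻¹) * of g * (t ^ (u : ℤ) * of c * t⁻¹)⁻¹ *
      (t ^ ((u : ℤ) * j))⁻¹ * (of k)⁻¹ : HNNExtension G A B φ) ∈ freeEnded φ := by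
  have hkA' : k⁻¹ ∉ A := by simpa using hkA
  have hkB' : k⁻¹ ∉ B := by simpa using hkB
  have tail : IsReduced A B (List.replicate j (-u, 1) ++ [(-u, k⁻¹)]) :=
    isReduced_replicate_append j (List.isChain_singleton _) (by simp)
  have head_tail : ∀ x ∈ (List.replicate j (-u, (1 : G)) ++ [(-u, k⁻¹)]).head?, x.1 = -u := by
    cases j <;> simp [List.replicate_succ]
  by_cases hgB : g ∈ B
  · by_cases hg1 : g = 1
    · subst hg1
      have hij : (i : ℤ) - j ≠ 0 := by
        simp only [and_true] at h
        omega
      convert t_zpow_mul_of_mem_freeEnded hkA' hkB' (d := u * (i - j))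
        (mul_ne_zero (by simp) hij) using 1
      rw [mul_sub, zpow_sub]
      simp only [map_one, map_inv, mul_one]
      group
    · obtain ⟨a, hag⟩ : ∃ a, φ a = ⟨g, hgB⟩ := φ.surjective _
      have hpinch : (t⁻¹ * of g * t : HNNExtension G A B φ) = of (a : G) := by
        have := t_mul_of (φ := φ) a
        rw [hag] at this
        rw [mul_assoc, ← this, inv_mul_cancel_left]
      have ha : (a : G) ≠ 1 := by
        intro h1
        have : a = 1 := Subtype.ext h1
        rw [this, map_one] at hag
        exact hg1 (congrArg Subtype.val hag).symm
      refine ⟨List.replicate i (u, 1) ++ (u, c * a * c⁻¹) :: List.replicate j (-u, 1), -u, k⁻¹,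
        ?_, hkA', hkB', ?_⟩
      · rw [List.append_assoc, List.cons_append]
        refine isReduced_replicate_append i (List.isChain_cons.2 ⟨fun x hx hmem => ?_, tail⟩)
          (by simp)
        exact absurd (hcu a a.2 hmem) ha
      · simp only [syllableProd_append, syllableProd_cons, syllableProd_replicate,
          syllableProd_nil, map_mul, ← hpinch, map_inv, Units.val_neg, neg_mul, zpow_neg]
        group
  · refine ⟨List.replicate i (u, 1) ++ (u, c) :: (-1, g) :: (1, c⁻¹) :: List.replicate j (-u, 1),
      -u, k⁻¹, ?_, hkA', hkB', ?_⟩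
    · rw [List.append_assoc, List.cons_append, List.cons_append, List.cons_append]
      refine isReduced_replicate_append i (List.isChain_cons.2 ⟨?_, List.isChain_cons.2 ⟨?_,
        List.isChain_cons.2 ⟨?_, tail⟩⟩⟩) (by simp)
      · intro x hx hmem
        obtain rfl : (-1, g) = x := by simpa using hx
        rcases Int.units_eq_one_or u with rfl | rfl
        · exact hc hmem
        · rfl
      · intro x hx hmem
        exact absurd hmem hgB
      · intro x hx hmem
        rw [head_tail x hx]
        have : c ∈ A := by simpa using hmem
        rw [hc this, neg_neg]
    · simp only [syllableProd_append, syllableProd_cons, syllableProd_replicate,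
        syllableProd_nil, map_inv, Units.val_neg, Units.val_one, neg_mul, zpow_neg, zpow_one]
      group

theorem exists_notMem_union [Nontrivial G] (hA : (A : Set G).Finite) (hB : (B : Set G).Finite)
    (φ : A ≃* B) (hg : ∃ g : G, (∀ a ∈ A, g⁻¹ * a * g ∈ A → a = 1) ∨
      (∀ a ∈ A, g⁻¹ * a * g ∈ B → a = 1)) : ∃ k, k ∉ A ∧ k ∉ B := by
  have key : A ≠ ⊤ ∧ B ≠ ⊤ := by
    have hiff : A = ⊤ ↔ B = ⊤ := by
      have hcard : Nat.card A = Nat.card B := Nat.card_congr φ.toEquiv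
      have hA' : Finite A := hA
      have hB' : Finite B := hB
      constructor
      · rintro rfl
        have : Finite G := Set.finite_univ_iff.1 hA
        rw [← Subgroup.card_eq_iff_eq_top, ← hcard, Subgroup.card_top]
      · rintro rfl
        have : Finite G := Set.finite_univ_iff.1 hB
        rw [← Subgroup.card_eq_iff_eq_top, hcard, Subgroup.card_top]
    have hA1 : A ≠ ⊤ := by
      intro hA1
      have hB1 := hiff.1 hA1
      obtain ⟨g, hg | hg⟩ := hg
      all_goals
        obtain ⟨a, ha⟩ := exists_ne (1 : G)
        exact ha (hg a (by simp [hA1]) (by simp [hA1, hB1]))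
    exact ⟨hA1, fun h => hA1 (hiff.2 h)⟩
  by_contra! hcon
  obtain ⟨a, ha⟩ : ∃ a, a ∉ A := by
    by_contra! h
    exact key.1 ((Subgroup.eq_top_iff' A).2 h)
  obtain ⟨b, hb⟩ : ∃ b, b ∉ B := by
    by_contra! h
    exact key.2 ((Subgroup.eq_top_iff' B).2 h)
  have hbA : b ∈ A := by
    by_contra h
    exact hb (hcon b h)
  have haB := hcon a ha
  by_cases hab : a * b ∈ A
  · exact ha ((Subgroup.mul_mem_cancel_right A hbA).1 hab)
  · exact hb ((Subgroup.mul_mem_cancel_left B haB).1 (hcon _ hab))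

theorem exists_conj_mem_toSubgroup (hg : ∃ g : G, (∀ a ∈ A, g⁻¹ * a * g ∈ A → a = 1) ∨
      (∀ a ∈ A, g⁻¹ * a * g ∈ B → a = 1)) :
    ∃ (c : G) (u : ℤˣ), (c ∈ A → u = -1) ∧
      ∀ a ∈ A, c * a * c⁻¹ ∈ toSubgroup A B u → a = 1 := by
  obtain ⟨g, hg | hg⟩ := hg
  · by_cases hgA : g ∈ A
    · have hA : ∀ a ∈ A, a = 1 := fun a ha =>
        hg a ha (A.mul_mem (A.mul_mem (A.inv_mem hgA) ha) hgA)
      exact ⟨1, -1, fun _ => rfl, fun a ha _ => hA a ha⟩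
    · exact ⟨g⁻¹, 1, fun h => absurd (inv_mem_iff.1 h) hgA, by simpa using hg⟩
  · exact ⟨g⁻¹, -1, fun _ => rfl, by simpa using hg⟩

/-- Labelled paths over the base group are encoded in submonoids of the HNN extension. -/
theorem exists_mem_closure_iff_labelledPath [Nontrivial G] (hA : (A : Set G).Finite)
    (hB : (B : Set G).Finite) (hg : ∃ g : G, (∀ a ∈ A, g⁻¹ * a * g ∈ A → a = 1) ∨
      (∀ a ∈ A, g⁻¹ * a * g ∈ B → a = 1)) (Q : Type*) [Finite Q] :
    ∃ f : Q → HNNExtension G A B φ, ∀ (E : Set (Q × G × Q)) p g q,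
      f p * of g * (f q)⁻¹ ∈ Submonoid.closure
        ((fun y : Q × G × Q => f y.1 * of y.2.1 * (f y.2.2)⁻¹) '' E) ↔ LabelledPath E p g q := by
  obtain ⟨k, hkA, hkB⟩ := exists_notMem_union hA hB φ hg
  obtain ⟨c, u, hc, hcu⟩ := exists_conj_mem_toSubgroup hg
  obtain ⟨n, hn⟩ : ∃ n : Q → ℕ, Function.Injective n := by
    obtain ⟨N, ⟨f⟩⟩ := Finite.exists_equiv_fin Q
    exact ⟨fun q => f q, Fin.val_injective.comp f.injective⟩
  refine ⟨fun q => t ^ ((u : ℤ) * n q) * of k * t ^ ((u : ℤ) * n q) *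
    (t ^ (u : ℤ) * of c * t⁻¹), mem_closure_iff_labelledPath of
    (fun q => t ^ ((u : ℤ) * n q)) (of k) (t ^ (u : ℤ) * of c * t⁻¹) (freeEnded φ) ?_ ?_ ?_ ?_⟩
  · intro i g j h
    exact conj_mem_freeEnded hc hcu hkA hkB (by rwa [hn.eq_iff])
  · intro i j hij
    rw [← zpow_neg, ← zpow_add]
    refine t_zpow_mul_of_mem_freeEnded hkA hkB ?_
    rw [neg_add_eq_sub, ← mul_sub]
    refine mul_ne_zero (by simp) (sub_ne_zero.2 ?_)
    exact_mod_cast hn.ne hij.symm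
  · simpa using of_notMem_freeEnded (φ := φ) 1
  · simpa using of_notMem_freeEnded (φ := φ) k⁻¹

end HNNExtension

theorem ComputablePred.of_step {α σ : Type*} [Primcodable α] [Finite σ]
    {R : List α → σ → Prop} {step : σ → α → σ → Prop}
    (hcons : ∀ a l s, R (a :: l) s ↔ ∃ s', step s a s' ∧ R l s')
    (hstep : ∀ s s', ComputablePred fun a => step s a s') (s : σ) :
    ComputablePred fun l => R l s := by
  let M : NFA α σ := ⟨fun s a => {s' | step s a s'}, {s}, {s | R [] s}⟩
  refine (M.computablePred_mem_accepts hstep).of_eq fun l => ?_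
  have key : ∀ (l : List α) (s : σ), (∃ s' ∈ M.accept, s' ∈ M.evalFrom {s} l) ↔ R l s := by
    intro l
    induction l with
    | nil => intro s; simp [M]
    | cons a l ih =>
      intro s
      rw [hcons, NFA.evalFrom_cons, NFA.stepSet_singleton]
      simp only [← ih]
      constructor
      · rintro ⟨s', hs', h⟩
        obtain ⟨s₁, hs₁, h⟩ := NFA.mem_evalFrom_iff_exists.1 h
        exact ⟨s₁, hs₁, s', hs', h⟩
      · rintro ⟨s₁, hs₁, s', hs', h⟩
        exact ⟨s', hs', NFA.mem_evalFrom_iff_exists.2 ⟨s₁, hs₁, h⟩⟩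
  exact key l s

section Words

theorem FreeMonoid.exists_ofList_eq {P Δ : Type*} [Monoid P] {e : FreeMonoid Δ →* P}
    (he : Function.Surjective e) (x : P) : ∃ w : List Δ, e (FreeMonoid.ofList w) = x :=
  he x

variable {P Δ Γ : Type*} [Group P] [Primcodable Δ] [Primcodable Γ] [Finite Γ]
  {e : FreeMonoid Δ →* P}

theorem FreeMonoid.exists_primrec_lift (he : Function.Surjective e) (ψ : FreeMonoid Γ →* P) :
    ∃ f : List Γ → List Δ, Primrec f ∧
      ∀ h, e (FreeMonoid.ofList (f h)) = ψ (FreeMonoid.ofList h) := by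
  choose σ hσ using fun γ : Γ => exists_ofList_eq he (ψ (FreeMonoid.of γ))
  refine ⟨fun h => h.flatMap σ, Primrec.list_flatMap Primrec.id
    ((Primrec.dom_finite σ).comp Primrec.snd).to₂, fun h => ?_⟩
  dsimp only
  induction h with
  | nil => simp
  | cons γ h ih =>
    rw [List.flatMap_cons, FreeMonoid.ofList_append, map_mul, ih, FreeMonoid.ofList_cons, map_mul,
      hσ]

theorem ComputablePred.comp_mul_mul (he : Function.Surjective e) (ψ : FreeMonoid Γ →* P)
    {p : P → Prop} (hp : ComputablePred fun w : List Δ => p (e (FreeMonoid.ofList w))) (x y : P) :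
    ComputablePred fun h : List Γ => p (x * ψ (FreeMonoid.ofList h) * y) := by
  obtain ⟨f, hf, hfψ⟩ := FreeMonoid.exists_primrec_lift he ψ
  obtain ⟨v, rfl⟩ := FreeMonoid.exists_ofList_eq he x
  obtain ⟨w, rfl⟩ := FreeMonoid.exists_ofList_eq he y
  refine (hp.comp_computable (f := fun h => v ++ f h ++ w)
    (Primrec.list_append.comp (Primrec.list_append.comp (Primrec.const _) hf)
      (Primrec.const _)).to_comp).of_eq fun h => ?_
  simp only [FreeMonoid.ofList_append, map_mul, hfψ]

theorem ComputablePred.map_eq_map [Finite Δ] (he : Function.Surjective e)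
    (h : ComputablePred fun w : List Δ => e (FreeMonoid.ofList w) = 1) :
    ComputablePred fun x : List Δ × List Δ =>
      e (FreeMonoid.ofList x.1) = e (FreeMonoid.ofList x.2) := by
  choose σ hσ using fun d : Δ => FreeMonoid.exists_ofList_eq he (e (FreeMonoid.of d))⁻¹
  have hinv : ∀ w : List Δ, e (FreeMonoid.ofList
      (w.reverse.flatMap σ)) = (e (FreeMonoid.ofList w))⁻¹ := by
    intro w
    induction w with
    | nil => simp
    | cons d w ih =>
      rw [List.reverse_cons, List.flatMap_append, FreeMonoid.ofList_append, map_mul, ih,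
        FreeMonoid.ofList_cons, map_mul, mul_inv_rev]
      simp [hσ]
  refine (h.comp_computable (f := fun x : List Δ × List Δ =>
    x.2.reverse.flatMap σ ++ x.1)
    (Primrec.list_append.comp (Primrec.list_flatMap (Primrec.list_reverse.comp Primrec.snd)
      ((Primrec.dom_finite σ).comp Primrec.snd).to₂) Primrec.fst).to_comp).of_eq fun x => ?_
  rw [FreeMonoid.ofList_append, map_mul, hinv, inv_mul_eq_one, eq_comm]

end Words

namespace HNNExtension

variable {G : Type*} [Group G] {A B : Subgroup G} {φ : A ≃* B}

variable (φ) in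
theorem closure_of_union_t_zpow :
    Submonoid.closure {x : HNNExtension G A B φ | (∃ g, x = of g) ∨ ∃ u : ℤˣ, x = t ^ (u : ℤ)} =
      ⊤ := by
  rw [eq_top_iff]
  rintro x -
  obtain ⟨g, m, -, rfl⟩ := exists_isReduced_eq φ x
  refine Submonoid.mul_mem _ (Submonoid.subset_closure (Or.inl ⟨g, rfl⟩)) ?_
  refine Submonoid.list_prod_mem _ fun y hy => ?_
  obtain ⟨z, -, rfl⟩ := List.mem_map.1 hy
  exact Submonoid.mul_mem _ (Submonoid.subset_closure (Or.inr ⟨z.1, rfl⟩))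
    (Submonoid.subset_closure (Or.inl ⟨z.2, rfl⟩))

section Computability

variable {Γ : Type*} [Primcodable Γ] [Primcodable ℤˣ] {ψ : FreeMonoid Γ →* G}

/-- Apply a homomorphism to the words in a list of syllables. -/
def mapWords (ψ : FreeMonoid Γ →* G) (m : List (ℤˣ × List Γ)) : List (ℤˣ × G) :=
  m.map fun x => (x.1, ψ (FreeMonoid.ofList x.2))

theorem computablePred_isReduced
    (h : ∀ u, ComputablePred fun h : List Γ => ψ (FreeMonoid.ofList h) ∈ toSubgroup A B u) :
    ComputablePred fun m : List (ℤˣ × List Γ) => IsReduced A B (mapWords ψ m) := by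
  let R : List (ℤˣ × List Γ) → Option ℤˣ → Prop := fun m s =>
    IsReduced A B (mapWords ψ m) ∧ ∀ u ∈ s, ∀ x ∈ m.head?, u = x.1
  let step : Option ℤˣ → ℤˣ × List Γ → Option ℤˣ → Prop := fun s x s' =>
    (∀ u ∈ s, u = x.1) ∧ ∃ v, x.1 = v ∧
      ((ψ (FreeMonoid.ofList x.2) ∈ toSubgroup A B v ∧ s' = some v) ∨
        (ψ (FreeMonoid.ofList x.2) ∉ toSubgroup A B v ∧ s' = none))
  refine (ComputablePred.of_step (R := R) (step := step) ?_ ?_ none).of_eq fun m => by simp [R]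
  · rintro ⟨v, h⟩ m s
    simp only [R, step, mapWords, IsReduced, List.map_cons, List.isChain_cons, List.head?_map]
    by_cases hv : ψ (FreeMonoid.ofList h) ∈ toSubgroup A B v <;> cases m <;> simp [hv] <;> tauto
  · intro s s'
    have hfst : ∀ p : ℤˣ → Prop, ComputablePred fun x : ℤˣ × List Γ => p x.1 := fun p =>
      (ComputablePred.of_finite p).comp_computable Computable.fst
    refine (hfst fun v => ∀ u ∈ s, u = v).and_pred (ComputablePred.exists_finite fun v =>
      (hfst (· = v)).and_pred ?_)
    exact (((h v).comp_computable Computable.snd).and_pred (ComputablePred.const_prop _)).or_pred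
      (((h v).comp_computable Computable.snd).not.and_pred (ComputablePred.const_prop _))

theorem computablePred_twistedReadsTo {Q : Type*} [Finite Q] (hA : (A : Set G).Finite)
    (hB : (B : Set G).Finite) {E : Set (Q × HNNExtension G A B φ × Q)}
    (h : ∀ p x y q, ComputablePred fun h : List Γ =>
      LabelledPath (baseEdges E) p (x * ψ (FreeMonoid.ofList h) * y) q)
    (q p : Q) {c : G} (hc : c ∈ (A ∪ B : Set G)) :
    ComputablePred fun m : List (ℤˣ × List Γ) => TwistedReadsTo E q (mapWords ψ m) p c := by
  have : Finite (A ∪ B : Set G) := hA.union hB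
  have hfst : ∀ p : ℤˣ → Prop, ComputablePred fun x : ℤˣ × List Γ => p x.1 := fun p =>
    (ComputablePred.of_finite p).comp_computable Computable.fst
  refine ComputablePred.of_step
    (R := fun m (s : Q × (A ∪ B : Set G)) => TwistedReadsTo E q (mapWords ψ m) s.1 s.2)
    (step := fun s x s' => ∃ p₁, ∃ c' ∈ (A ∪ B : Set G), ((s.1, t ^ (x.1 : ℤ), p₁) ∈ E ∧
        (of (s.2 : G) * t ^ (x.1 : ℤ) : HNNExtension G A B φ) = t ^ (x.1 : ℤ) * of c') ∧
        LabelledPath (baseEdges E) p₁ (c' * ψ (FreeMonoid.ofList x.2) * (s'.2 : G)⁻¹) s'.1)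
    ?_ ?_ (p, ⟨c, hc⟩)
  · rintro ⟨u, h⟩ m ⟨p, c⟩
    constructor
    · rintro ⟨p₂, c₂, hc₂, ⟨p₁, c', hc', he, hcc', hp⟩, hm⟩
      exact ⟨(p₂, ⟨c₂, hc₂⟩), ⟨p₁, c', hc', ⟨he, hcc'⟩, hp⟩, hm⟩
    · rintro ⟨⟨p₂, c₂, hc₂⟩, ⟨p₁, c', hc', ⟨he, hcc'⟩, hp⟩, hm⟩
      exact ⟨p₂, c₂, hc₂, ⟨p₁, c', hc', he, hcc', hp⟩, hm⟩
  · intro s s'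
    exact ComputablePred.exists_finite fun p₁ => ComputablePred.exists_mem_finite
      (hA.union hB) fun c' _ => (hfst fun u => (s.1, t ^ (u : ℤ), p₁) ∈ E ∧
        (of (s.2 : G) * t ^ (u : ℤ) : HNNExtension G A B φ) = t ^ (u : ℤ) * of c').and_pred
          ((h _ _ _ _).comp_computable Computable.snd)

end Computability

end HNNExtension

namespace HNNExtension

variable {G : Type*} [Group G] {A B : Subgroup G} {φ : A ≃* B}
  {Δ Γ : Type*} [Primcodable Δ] [Primcodable Γ] [Finite Γ]
  {e : FreeMonoid Δ →* HNNExtension G A B φ}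

theorem computablePred_labelledPath_of (hA : (A : Set G).Finite) (hB : (B : Set G).Finite)
    (hg : ∃ g : G, (∀ a ∈ A, g⁻¹ * a * g ∈ A → a = 1) ∨ (∀ a ∈ A, g⁻¹ * a * g ∈ B → a = 1))
    (he : Function.Surjective e)
    (hsub : ∀ S : Set (HNNExtension G A B φ), S.Finite →
      ComputablePred fun w : List Δ => e (FreeMonoid.ofList w) ∈ Submonoid.closure S)
    (ψ : FreeMonoid Γ →* G) {Q : Type*} [Finite Q] {E : Set (Q × G × Q)} (hE : E.Finite)
    (p : Q) (x y : G) (q : Q) :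
    ComputablePred fun h : List Γ => LabelledPath E p (x * ψ (FreeMonoid.ofList h) * y) q := by
  rcases subsingleton_or_nontrivial G with _ | _
  · exact (ComputablePred.const_prop (LabelledPath E p 1 q)).of_eq fun h => by
      rw [Subsingleton.elim (x * ψ (FreeMonoid.ofList h) * y) 1]
  · obtain ⟨f, hf⟩ := exists_mem_closure_iff_labelledPath (φ := φ) hA hB hg Q
    refine (ComputablePred.comp_mul_mul he (of.comp ψ) (hsub _ (hE.image
      fun y : Q × G × Q => f y.1 * of y.2.1 * (f y.2.2)⁻¹)) (f p * of x)
      (of y * (f q)⁻¹)).of_eq fun h => ?_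
    rw [← hf E p _ q, map_mul, map_mul]
    simp only [mul_assoc, MonoidHom.comp_apply]

theorem computablePred_mem_image [Finite Δ] (hGfg : Group.FG G) (hA : (A : Set G).Finite)
    (hB : (B : Set G).Finite)
    (hg : ∃ g : G, (∀ a ∈ A, g⁻¹ * a * g ∈ A → a = 1) ∨ (∀ a ∈ A, g⁻¹ * a * g ∈ B → a = 1))
    (he : Function.Surjective e)
    (hsub : ∀ S : Set (HNNExtension G A B φ), S.Finite →
      ComputablePred fun w : List Δ => e (FreeMonoid.ofList w) ∈ Submonoid.closure S)
    {L : Language Δ} (hL : L.IsRegular) :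
    ComputablePred fun w : List Δ =>
      e (FreeMonoid.ofList w) ∈ (fun v : List Δ => e (FreeMonoid.ofList v)) '' L := by
  classical
  obtain ⟨Γ, _, ψ, hψ⟩ := Monoid.fg_iff_exists_freeGroup_hom_surjective_finite.1
    (Group.fg_iff_monoid_fg.1 hGfg)
  have := Fintype.ofFinite Γ
  have hone : ComputablePred fun w : List Δ => e (FreeMonoid.ofList w) = 1 :=
    (hsub ∅ Set.finite_empty).of_eq fun w => by simp
  have hword := ComputablePred.map_eq_map he hone
  have hmem : ∀ u, ComputablePred fun h : List Γ =>
      ψ (FreeMonoid.ofList h) ∈ toSubgroup A B u := by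
    intro u
    have hfin : (toSubgroup A B u : Set G).Finite :=
      (hA.union hB).subset (toSubgroup_le_union A B u)
    refine (ComputablePred.exists_mem_finite hfin
      (p := fun a h => ψ (FreeMonoid.ofList h) = a) fun a _ => ?_).of_eq fun h => by simp
    refine (ComputablePred.comp_mul_mul (p := (· = 1)) he (of.comp ψ) hone 1
      (of a)⁻¹).of_eq fun h => ?_
    rw [one_mul, mul_inv_eq_one, MonoidHom.comp_apply, (of_injective (φ := φ)).eq_iff]
  obtain ⟨Q, _, E, p₀, F, hE, hES, hEL⟩ := Language.IsRegular.exists_labelledPath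
    (by exact Or.inl ⟨1, (map_one of).symm⟩) (closure_of_union_t_zpow φ) e hL
  have hbase := fun p x y q => computablePred_labelledPath_of hA hB hg he hsub ψ
    (finite_baseEdges hA hB hE) p x y q
  obtain ⟨f, hf, hfψ⟩ := FreeMonoid.exists_primrec_lift he ((of (φ := φ)).comp ψ)
  choose τ hτ using fun u : ℤˣ =>
    FreeMonoid.exists_ofList_eq he (t ^ (u : ℤ) : HNNExtension G A B φ)
  let word : List Γ × List (ℤˣ × List Γ) → List Δ := fun b =>
    f b.1 ++ b.2.flatMap fun x => τ x.1 ++ f x.2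
  have hcomp : Primrec word := Primrec.list_append.comp (hf.comp Primrec.fst)
    (Primrec.list_flatMap Primrec.snd (Primrec.list_append.comp
      ((Primrec.dom_finite τ).comp (Primrec.fst.comp Primrec.snd))
      (hf.comp (Primrec.snd.comp Primrec.snd))).to₂)
  have hword_eq : ∀ b, e (FreeMonoid.ofList (word b)) =
      of (ψ (FreeMonoid.ofList b.1)) * syllableProd φ (mapWords ψ b.2) := by
    rintro ⟨h, m⟩
    dsimp only [word]
    rw [FreeMonoid.ofList_append, map_mul, hfψ, MonoidHom.comp_apply]
    congr 1
    induction m with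
    | nil => simp [mapWords]
    | cons x m ih =>
      rw [List.flatMap_cons, FreeMonoid.ofList_append, map_mul, ih, FreeMonoid.ofList_append,
        map_mul, hτ, hfψ]
      simp [mapWords]
  have hlift : ∀ m : List (ℤˣ × G), ∃ m', mapWords ψ m' = m := by
    intro m
    induction m with
    | nil => exact ⟨[], rfl⟩
    | cons x m ih =>
      obtain ⟨m', rfl⟩ := ih
      obtain ⟨h, hh⟩ := FreeMonoid.exists_ofList_eq hψ x.2
      exact ⟨(x.1, h) :: m', by simp [mapWords, hh]⟩
  refine ComputablePred.of_exists_witness (β := List Γ × List (ℤˣ × List Γ))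
    (C := fun w b => IsReduced A B (mapWords ψ b.2) ∧
      e (FreeMonoid.ofList w) = e (FreeMonoid.ofList (word b)))
    (q := fun b => ∃ q ∈ F, ∃ p₁, ∃ c ∈ (A ∪ B : Set G),
      LabelledPath (baseEdges E) p₀ (1 * ψ (FreeMonoid.ofList b.1) * c⁻¹) p₁ ∧
        TwistedReadsTo E q (mapWords ψ b.2) p₁ c) ?_ ?_ ?_ ?_
  · exact ((computablePred_isReduced hmem).comp_computable
      (Computable.snd.comp Computable.snd)).and_pred
      (hword.comp_computable (Computable.fst.pair (hcomp.to_comp.comp Computable.snd)))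
  · exact ComputablePred.exists_mem_finite (Set.toFinite F) fun q _ =>
      ComputablePred.exists_finite fun p₁ => ComputablePred.exists_mem_finite (hA.union hB)
        fun c hc => ((hbase _ _ _ _).comp_computable Computable.fst).and_pred
          ((computablePred_twistedReadsTo hA hB hbase q p₁ hc).comp_computable Computable.snd)
  · intro w
    obtain ⟨g, m, hm, hgm⟩ := exists_isReduced_eq φ (e (FreeMonoid.ofList w))
    obtain ⟨m, rfl⟩ := hlift m
    obtain ⟨h, rfl⟩ := FreeMonoid.exists_ofList_eq hψ g
    exact ⟨(h, m), hm, by rw [hgm, hword_eq]⟩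
  · rintro w b ⟨hb, hwb⟩
    rw [hEL, hwb, hword_eq]
    simp only [labelledPath_iff_twistedReadsTo hES hb, one_mul]

end HNNExtension

/-- For an HNN extension of a finitely generated group `G` with finite associated
subgroups `A ≃* B` such that some `g ∈ G` conjugates `A` off `A` or off `B`, the
submonoid membership problem and the rational subset membership problem are
recursively equivalent. -/
theorem hnn_submonoidMembership_iff_rationalSubsetMembership
    {G : Type*} [Group G] (hGfg : Group.FG G)
    (A B : Subgroup G) (hAfin : (A : Set G).Finite) (hBfin : (B : Set G).Finite)
    (φ : A ≃* B)
    (hg : ∃ g : G, (∀ a ∈ A, g⁻¹ * a * g ∈ A → a = 1) ∨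
                   (∀ a ∈ A, g⁻¹ * a * g ∈ B → a = 1))
    {Δ : Type} [Fintype Δ] [DecidableEq Δ]
    (e : FreeMonoid Δ →* HNNExtension G A B φ) (he : Function.Surjective e) :
    (∀ W : Set (List Δ), W.Finite →
      ComputablePred (fun w : List Δ =>
        e (FreeMonoid.ofList w) ∈
          Submonoid.closure ((fun v : List Δ => e (FreeMonoid.ofList v)) '' W)))
    ↔ (∀ L : Language Δ, L.IsRegular →
      ComputablePred (fun w : List Δ =>
        e (FreeMonoid.ofList w) ∈ (fun v : List Δ => e (FreeMonoid.ofList v)) '' L)) := by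
  constructor
  · intro h L hL
    refine HNNExtension.computablePred_mem_image hGfg hAfin hBfin hg he (fun S hS => ?_) hL
    choose w hw using fun x => FreeMonoid.exists_ofList_eq he x
    refine (h (w '' S) (hS.image w)).of_eq fun v => ?_
    rw [Set.image_image]
    simp only [hw, Set.image_id']
  · intro h W hW
    exact (h _ (Language.isRegular_kstar_of_finite (W := W) hW)).of_eq fun w =>
      (Set.ext_iff.1 (Submonoid.closure_image_eq_image_kstar e W) _).symm
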